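/- (Lemma 2, second identity.) For every ν ∈ ℝ, every integer n ≥ 1, and every admissible θ ∈ ℂ^n: K̃_n^{−}(θ) = (−1)^{n+1} · K̃_n^{+}(θ); i.e. K̃_n^{+} and K̃_n^{−} coincide for odd n and are opposite for even n. -/

import Mathlib

open Finset

/-- The K-function `K_n[p](θ)` from the paper (eq. (1.2)):
`K_n[p](θ) = Σ_{l ∈ {0,1}^n} (−1)^{l_1+…+l_n} Π_{i<j} (1 + (l_i − l_j)·i·sin(πν)/sinh(θ_i − θ_j)) · p(θ,l)`. -/
noncomputable def Kfun (ν : ℝ) {n : ℕ} (p : (Fin n → ℂ) → (Fin n → Fin 2) → ℂ)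
    (θ : Fin n → ℂ) : ℂ :=
  ∑ l : Fin n → Fin 2,
    (-1 : ℂ) ^ (∑ i, (l i : ℕ)) *
    (∏ i : Fin n, ∏ j : Fin n,
      if (i : ℕ) < (j : ℕ) then
        1 + (((l i : ℕ) : ℂ) - ((l j : ℕ) : ℂ)) * Complex.I *
          (Real.sin (Real.pi * ν) : ℂ) / Complex.sinh (θ i - θ j)
      else 1) *
    p θ l

/-- `θ` is admissible if `sinh(θ_i − θ_j) ≠ 0` for all `i < j`. -/
def Admissible {n : ℕ} (θ : Fin n → ℂ) : Prop :=
  ∀ i j : Fin n, i < j → Complex.sinh (θ i - θ j) ≠ 0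

/-- p-function of the special exponentials `e^{±iβφ}` (ε = ±1):
`p^{±}(θ,l) = (Σ_i e^{∓θ_i}) · (Σ_i e^{±(θ_i − (iπ/2)(1 − (−1)^{l_i} ν))})`. -/
noncomputable def pPM (ν : ℝ) (ε : ℂ) {n : ℕ} : (Fin n → ℂ) → (Fin n → Fin 2) → ℂ :=
  fun θ l => (∑ i, Complex.exp (-ε * θ i)) *
    (∑ i, Complex.exp (ε * (θ i -
      (Real.pi : ℂ) * Complex.I / 2 * (1 - (-1 : ℂ) ^ (l i : ℕ) * (ν : ℂ)))))

/-- The signed weight of the configuration that equals `1` on `T` and `0` on `s \ T`,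
in multiplicative variables `x i`. -/
noncomputable def crossWeight {ι F : Type*} [DecidableEq ι] [Field F]
    (c : F) (x : ι → F) (s T : Finset ι) : F :=
  (-1) ^ #T * ∏ i ∈ T, ∏ j ∈ s \ T, (1 + c * x i * x j / (x i ^ 2 - x j ^ 2))

/-- The sum over configurations on `s` of the function `p`, with the signed weights
`crossWeight`. -/
noncomputable def crossSum {ι F : Type*} [DecidableEq ι] [Field F]
    (c : F) (x : ι → F) (s : Finset ι) (p : Finset ι → F) : F :=
  ∑ T ∈ s.powerset, crossWeight c x s T * p T

/-- The product of the quadratics `X ^ 2 + e j * X - x j ^ 2`. -/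
noncomputable def quadProd {ι F : Type*} [Field F]
    (e x : ι → F) (s : Finset ι) : Polynomial F :=
  ∏ j ∈ s, (Polynomial.X ^ 2 + Polynomial.C (e j) * Polynomial.X - Polynomial.C (x j ^ 2))

/-- The sum over configurations on `s` and one further site, as a polynomial in the variable
of that site, after clearing denominators. -/
noncomputable def clearedSum {ι F : Type*} [DecidableEq ι] [Field F]
    (c : F) (x : ι → F) (s : Finset ι) (p₀ p₁ : Finset ι → Polynomial F) : Polynomial F :=
  ∑ T ∈ s.powerset, Polynomial.C (crossWeight c x s T) *
    (quadProd (fun j => if j ∈ T then -(c * x j) else 0) x s * p₀ T -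
      quadProd (fun j => if j ∈ T then 0 else c * x j) x s * p₁ T)

section

variable {ι F : Type*} [Field F] {x : ι → F}

lemma eval_quadProd (e x : ι → F) (s : Finset ι) (y : F) :
    (quadProd e x s).eval y = ∏ j ∈ s, (y ^ 2 + e j * y - x j ^ 2) := by
  simp [quadProd, Polynomial.eval_prod]

lemma prod_mul_prod_one_sub_div {T : Finset ι} {u v : ι → F} (hu : ∀ j ∈ T, u j ≠ 0) :
    (∏ j ∈ T, u j) * ∏ j ∈ T, (1 - v j / u j) = ∏ j ∈ T, (u j - v j) := by
  rw [← Finset.prod_mul_distrib]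
  refine Finset.prod_congr rfl fun j hj => ?_
  have := hu j hj
  field_simp

lemma prod_mul_prod_one_add_div {T : Finset ι} {u v : ι → F} (hu : ∀ j ∈ T, u j ≠ 0) :
    (∏ j ∈ T, u j) * ∏ j ∈ T, (1 + v j / u j) = ∏ j ∈ T, (u j + v j) := by
  rw [← Finset.prod_mul_distrib]
  refine Finset.prod_congr rfl fun j hj => ?_
  have := hu j hj
  field_simp

/-- A polynomial of degree less than `2 * #s` vanishing at all `± x i` vanishes. -/
lemma eq_zero_of_eval_pm {s : Finset ι} (h2 : (2 : F) ≠ 0) (hx : ∀ i, x i ≠ 0)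
    (hd : ∀ i ∈ s, ∀ j ∈ s, i ≠ j → x i ^ 2 - x j ^ 2 ≠ 0) {R : Polynomial F}
    (hdeg : R.degree < ((2 * #s : ℕ) : WithBot ℕ)) (hpos : ∀ i ∈ s, R.eval (x i) = 0)
    (hneg : ∀ i ∈ s, R.eval (-x i) = 0) : R = 0 := by
  classical
  have inj : Set.InjOn x s := by
    intro i hi j hj hij
    by_contra hne
    exact hd i hi j hj hne (by rw [hij, sub_self])
  have hdisj : Disjoint (s.image x) (s.image fun i => -x i) := by
    rw [Finset.disjoint_left]
    intro a ha hb
    obtain ⟨i, hi, rfl⟩ := Finset.mem_image.1 ha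
    obtain ⟨j, hj, hij⟩ := Finset.mem_image.1 hb
    by_cases hne : i = j
    · subst hne
      have : 2 * x i = 0 := by linear_combination -hij
      exact (mul_ne_zero h2 (hx i)) this
    · exact hd i hi j hj hne (by rw [← hij]; ring)
  refine Polynomial.eq_zero_of_degree_lt_of_eval_finset_eq_zero
    (s.image x ∪ s.image fun i => -x i) ?_ ?_
  · rw [Finset.card_union_of_disjoint hdisj, Finset.card_image_of_injOn inj,
      Finset.card_image_of_injOn (f := fun i => -x i) (neg_injective.comp_injOn inj), ← two_mul]
    exact hdeg
  · intro a ha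
    rcases Finset.mem_union.1 ha with ha | ha <;> obtain ⟨i, hi, rfl⟩ := Finset.mem_image.1 ha
    · exact hpos i hi
    · exact hneg i hi

lemma degree_X_mul_quadProd_sub (e x : ι → F) (s : Finset ι) :
    (Polynomial.X * quadProd e x s - Polynomial.X ^ (2 * #s) *
      (Polynomial.X + Polynomial.C (∑ j ∈ s, e j))).degree < ((2 * #s : ℕ) : WithBot ℕ) := by
  classical
  induction s using Finset.induction_on with
  | empty => simp [quadProd]
  | insert k s hk ih =>
    have key : Polynomial.X * quadProd e x (insert k s) - Polynomial.X ^ (2 * #(insert k s)) *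
        (Polynomial.X + Polynomial.C (∑ j ∈ insert k s, e j)) =
        (Polynomial.C 1 * Polynomial.X ^ 2 + Polynomial.C (e k) * Polynomial.X +
            Polynomial.C (-x k ^ 2)) *
          (Polynomial.X * quadProd e x s - Polynomial.X ^ (2 * #s) *
            (Polynomial.X + Polynomial.C (∑ j ∈ s, e j))) +
        Polynomial.X ^ (2 * #s) *
          (Polynomial.C (e k * (∑ j ∈ s, e j) - x k ^ 2) * Polynomial.X +
            Polynomial.C (-x k ^ 2 * ∑ j ∈ s, e j)) := by
      rw [quadProd, Finset.prod_insert hk, ← quadProd, Finset.sum_insert hk,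
        Finset.card_insert_of_notMem hk]
      simp only [map_add, map_sub, map_mul, map_neg, map_one, map_pow]
      ring
    rw [key, Finset.card_insert_of_notMem hk, Nat.mul_succ, Nat.cast_add]
    refine (Polynomial.degree_add_le _ _).trans_lt (max_lt ?_ ?_)
    · rw [Polynomial.degree_mul, Polynomial.degree_quadratic one_ne_zero, add_comm]
      exact WithBot.add_lt_add_right (by decide) ih
    · rw [Polynomial.degree_mul, Polynomial.degree_X_pow]
      exact WithBot.add_lt_add_left (WithBot.natCast_ne_bot _) Polynomial.degree_linear_lt

lemma degree_lt_of_degree_X_mul_lt {R : Polynomial F} {k : ℕ}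
    (h : (Polynomial.X * R).degree < ((k + 1 : ℕ) : WithBot ℕ)) :
    R.degree < (k : WithBot ℕ) := by
  rw [Polynomial.degree_lt_iff_coeff_zero] at h ⊢
  intro m hm
  rw [← Polynomial.coeff_X_mul]
  exact h (m + 1) (by omega)

/-- The summand of the balance identity for a configuration `T` on `s` and a further site, times
the variable of that site, as a polynomial in that variable. -/
noncomputable def balancePoly (x : ι → F) (s : Finset ι) (σ : F) (T : Finset ι) :
    Polynomial F :=
  Polynomial.C (∑ i ∈ T, (x i)⁻¹) * Polynomial.X ^ 2 +
    Polynomial.C ((∑ i ∈ s, x i) * (∑ i ∈ T, (x i)⁻¹) +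
      σ * (∑ i ∈ s, (x i)⁻¹) * ∑ i ∈ T, x i) * Polynomial.X +
    Polynomial.C (σ * ∑ i ∈ T, x i)

/-- The change of `balancePoly` when the further site is added to the configuration. -/
noncomputable def balanceShift (x : ι → F) (s : Finset ι) (σ : F) : Polynomial F :=
  Polynomial.C (σ * ∑ i ∈ s, (x i)⁻¹) * Polynomial.X ^ 2 + Polynomial.C (1 + σ) * Polynomial.X +
    Polynomial.C (∑ i ∈ s, x i)

lemma eval_balancePoly (x : ι → F) (s : Finset ι) (σ : F) (T : Finset ι) (y : F) :
    (balancePoly x s σ T).eval y =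
      (y ^ 2 + (∑ i ∈ s, x i) * y) * (∑ i ∈ T, (x i)⁻¹) +
        σ * (1 + (∑ i ∈ s, (x i)⁻¹) * y) * ∑ i ∈ T, x i := by
  simp only [balancePoly, Polynomial.eval_add, Polynomial.eval_mul, Polynomial.eval_C,
    Polynomial.eval_pow, Polynomial.eval_X]
  ring

lemma eval_balanceShift (x : ι → F) (s : Finset ι) (σ y : F) :
    (balanceShift x s σ).eval y =
      y + (∑ i ∈ s, x i) + σ * (y + (∑ i ∈ s, (x i)⁻¹) * y ^ 2) := by
  simp only [balanceShift, Polynomial.eval_add, Polynomial.eval_mul, Polynomial.eval_C,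
    Polynomial.eval_pow, Polynomial.eval_X]
  ring

end

section

variable {ι F : Type*} [DecidableEq ι] [Field F] {c : F} {x : ι → F} {s : Finset ι}

lemma crossWeight_insert_of_notMem {n : ι} (hn : n ∉ s) {T : Finset ι} (hT : T ⊆ s) :
    crossWeight c x (insert n s) T =
      crossWeight c x s T * ∏ j ∈ T, (1 - c * x n * x j / (x n ^ 2 - x j ^ 2)) := by
  have hnT : n ∉ T := fun h => hn (hT h)
  have hns : n ∉ s \ T := fun h => hn (Finset.mem_sdiff.1 h).1
  unfold crossWeight
  rw [Finset.insert_sdiff_of_notMem _ hnT, mul_assoc, ← Finset.prod_mul_distrib]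
  congr 1
  refine Finset.prod_congr rfl fun i _ => ?_
  rw [Finset.prod_insert hns, mul_comm]
  congr 1
  rw [← neg_sub (x n ^ 2), div_neg, ← sub_eq_add_neg]
  ring

lemma crossWeight_insert_insert {n : ι} (hn : n ∉ s) {T : Finset ι} (hT : T ⊆ s) :
    crossWeight c x (insert n s) (insert n T) =
      -(crossWeight c x s T * ∏ j ∈ s \ T, (1 + c * x n * x j / (x n ^ 2 - x j ^ 2))) := by
  have hnT : n ∉ T := fun h => hn (hT h)
  unfold crossWeight
  have h : insert n s \ insert n T = s \ T := by
    ext a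
    simp only [Finset.mem_sdiff, Finset.mem_insert]
    constructor
    · rintro ⟨h1 | h1, h2⟩ <;> tauto
    · rintro ⟨h1, h2⟩
      refine ⟨Or.inr h1, ?_⟩
      rintro (rfl | h3)
      · exact hn h1
      · exact h2 h3
  rw [h, Finset.prod_insert hnT, Finset.card_insert_of_notMem hnT]
  ring

lemma prod_ite_mem_of_subset {T : Finset ι} (hT : T ⊆ s) (f g : ι → F) :
    ∏ j ∈ s, (if j ∈ T then f j else g j) = (∏ j ∈ T, f j) * ∏ j ∈ s \ T, g j := by
  rw [← Finset.prod_sdiff hT, mul_comm]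
  congr 1
  · exact Finset.prod_congr rfl fun j hj => if_pos hj
  · exact Finset.prod_congr rfl fun j hj => if_neg (Finset.mem_sdiff.1 hj).2

lemma eval_quadProd_neg {T : Finset ι} (hT : T ⊆ s) (y : F) :
    (quadProd (fun j => if j ∈ T then -(c * x j) else 0) x s).eval y =
      (∏ j ∈ T, (y ^ 2 - x j ^ 2 - c * y * x j)) * ∏ j ∈ s \ T, (y ^ 2 - x j ^ 2) := by
  rw [eval_quadProd, ← prod_ite_mem_of_subset hT]
  refine Finset.prod_congr rfl fun j _ => ?_
  split_ifs <;> ring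

lemma eval_quadProd_pos {T : Finset ι} (hT : T ⊆ s) (y : F) :
    (quadProd (fun j => if j ∈ T then 0 else c * x j) x s).eval y =
      (∏ j ∈ T, (y ^ 2 - x j ^ 2)) * ∏ j ∈ s \ T, (y ^ 2 - x j ^ 2 + c * y * x j) := by
  rw [eval_quadProd, ← prod_ite_mem_of_subset hT]
  refine Finset.prod_congr rfl fun j _ => ?_
  split_ifs <;> ring

lemma eval_clearedSum (p₀ p₁ : Finset ι → Polynomial F) (y : F) :
    (clearedSum c x s p₀ p₁).eval y = ∑ T ∈ s.powerset, crossWeight c x s T *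
      ((∏ j ∈ T, (y ^ 2 - x j ^ 2 - c * y * x j)) * (∏ j ∈ s \ T, (y ^ 2 - x j ^ 2)) *
          (p₀ T).eval y -
        (∏ j ∈ T, (y ^ 2 - x j ^ 2)) * (∏ j ∈ s \ T, (y ^ 2 - x j ^ 2 + c * y * x j)) *
          (p₁ T).eval y) := by
  rw [clearedSum, Polynomial.eval_finsetSum]
  refine Finset.sum_congr rfl fun T hT => ?_
  rw [Finset.mem_powerset] at hT
  rw [Polynomial.eval_mul, Polynomial.eval_sub, Polynomial.eval_mul, Polynomial.eval_mul,
    Polynomial.eval_C, eval_quadProd_neg hT, eval_quadProd_pos hT]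

lemma eval_clearedSum_eq_crossSum_insert {n : ι} (hn : n ∉ s)
    (hd : ∀ j ∈ s, x n ^ 2 - x j ^ 2 ≠ 0) (p₀ p₁ : Finset ι → Polynomial F)
    (p : Finset ι → F) (h₀ : ∀ T ⊆ s, (p₀ T).eval (x n) = p T)
    (h₁ : ∀ T ⊆ s, (p₁ T).eval (x n) = p (insert n T)) :
    (clearedSum c x s p₀ p₁).eval (x n) =
      (∏ j ∈ s, (x n ^ 2 - x j ^ 2)) * crossSum c x (insert n s) p := by
  rw [eval_clearedSum, crossSum, Finset.sum_powerset_insert hn, ← Finset.sum_add_distrib,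
    Finset.mul_sum]
  refine Finset.sum_congr rfl fun T hT => ?_
  rw [Finset.mem_powerset] at hT
  rw [crossWeight_insert_of_notMem hn hT, crossWeight_insert_insert hn hT, h₀ T hT, h₁ T hT,
    ← prod_mul_prod_one_sub_div (fun j hj => hd j (hT hj)),
    ← prod_mul_prod_one_add_div (fun j hj => hd j (Finset.mem_sdiff.1 hj).1),
    ← Finset.prod_sdiff hT]
  ring

lemma eval_clearedSum_insert {k : ι} (hk : k ∉ s) (hd : ∀ j ∈ s, x k ^ 2 - x j ^ 2 ≠ 0)
    (p₀ p₁ : Finset ι → Polynomial F) {y : F} (hy : y ^ 2 = x k ^ 2) :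
    (clearedSum c x (insert k s) p₀ p₁).eval y =
      c * y * x k * ∑ T ∈ s.powerset, crossWeight c x s T *
        ((∏ j ∈ T, (x k ^ 2 - x j ^ 2 - c * y * x j)) *
            (∏ j ∈ s \ T, (x k ^ 2 - x j ^ 2 + c * x k * x j)) * (p₀ (insert k T)).eval y -
          (∏ j ∈ T, (x k ^ 2 - x j ^ 2 - c * x k * x j)) *
            (∏ j ∈ s \ T, (x k ^ 2 - x j ^ 2 + c * y * x j)) * (p₁ T).eval y) := by
  rw [eval_clearedSum, Finset.sum_powerset_insert hk, ← Finset.sum_add_distrib, Finset.mul_sum]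
  refine Finset.sum_congr rfl fun T hT => ?_
  rw [Finset.mem_powerset] at hT
  have hkT : k ∉ T := fun h => hk (hT h)
  have hks : k ∉ s \ T := fun h => hk (Finset.mem_sdiff.1 h).1
  have h : insert k s \ insert k T = s \ T := by
    rw [Finset.insert_sdiff_insert, Finset.sdiff_insert_of_notMem hk]
  rw [crossWeight_insert_of_notMem hk hT, crossWeight_insert_insert hk hT, h,
    Finset.insert_sdiff_of_notMem _ hkT, Finset.prod_insert hkT, Finset.prod_insert hkT,
    Finset.prod_insert hks, Finset.prod_insert hks, hy,
    ← prod_mul_prod_one_sub_div (v := fun j => c * x k * x j) (fun j hj => hd j (hT hj)),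
    ← prod_mul_prod_one_add_div (v := fun j => c * x k * x j)
      (fun j hj => hd j (Finset.mem_sdiff.1 hj).1)]
  ring

lemma eval_clearedSum_insert_self {k : ι} (hk : k ∉ s) (hd : ∀ j ∈ s, x k ^ 2 - x j ^ 2 ≠ 0)
    {p₀ p₁ : Finset ι → Polynomial F}
    (hp : ∀ T ⊆ s, (p₀ (insert k T)).eval (x k) = (p₁ T).eval (x k)) :
    (clearedSum c x (insert k s) p₀ p₁).eval (x k) = 0 := by
  rw [eval_clearedSum_insert hk hd p₀ p₁ rfl]
  refine mul_eq_zero_of_right _ (Finset.sum_eq_zero fun T hT => ?_)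
  rw [hp T (Finset.mem_powerset.1 hT)]
  ring

lemma eval_clearedSum_insert_neg {k : ι} (hk : k ∉ s) (hd : ∀ j ∈ s, x k ^ 2 - x j ^ 2 ≠ 0)
    (p₀ p₁ : Finset ι → Polynomial F) :
    (clearedSum c x (insert k s) p₀ p₁).eval (-x k) =
      -(c * x k ^ 2) *
        ((∏ j ∈ s, (x k ^ 2 - x j ^ 2 + c * x k * x j)) *
            crossSum c x s (fun T => (p₀ (insert k T)).eval (-x k)) -
          (∏ j ∈ s, (x k ^ 2 - x j ^ 2 - c * x k * x j)) *
            crossSum c x s (fun T => (p₁ T).eval (-x k))) := by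
  rw [eval_clearedSum_insert hk hd p₀ p₁ (neg_sq _), crossSum, crossSum, Finset.mul_sum _ _ (∏ j ∈ s, _),
    Finset.mul_sum _ _ (∏ j ∈ s, _), ← Finset.sum_sub_distrib, Finset.mul_sum, Finset.mul_sum]
  refine Finset.sum_congr rfl fun T hT => ?_
  rw [← Finset.prod_sdiff (Finset.mem_powerset.1 hT),
    ← Finset.prod_sdiff (Finset.mem_powerset.1 hT)]
  simp only [mul_neg, neg_mul, sub_neg_eq_add, ← sub_eq_add_neg]
  ring

/-- The two leading coefficients of the cleared sum. -/
lemma degree_X_mul_clearedSum_sub {d : ℕ} {p₀ p₁ : Finset ι → Polynomial F}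
    (h₀ : ∀ T, (p₀ T).degree ≤ (d : WithBot ℕ)) (h₁ : ∀ T, (p₁ T).degree ≤ (d : WithBot ℕ)) :
    (Polynomial.X * clearedSum c x s p₀ p₁ - Polynomial.X ^ (2 * #s) *
      ∑ T ∈ s.powerset, Polynomial.C (crossWeight c x s T) *
        ((Polynomial.X + Polynomial.C (-(c * ∑ j ∈ T, x j))) * p₀ T -
          (Polynomial.X + Polynomial.C (c * (∑ j ∈ s, x j - ∑ j ∈ T, x j))) * p₁ T)).degree <
      ((2 * #s + d : ℕ) : WithBot ℕ) := by
  rw [clearedSum, Finset.mul_sum, Finset.mul_sum, ← Finset.sum_sub_distrib]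
  refine (Polynomial.degree_sum_le _ _).trans_lt ?_
  rw [Finset.sup_lt_iff (WithBot.bot_lt_coe _)]
  intro T hT
  rw [Finset.mem_powerset] at hT
  have e₀ : ∑ j ∈ s, (if j ∈ T then -(c * x j) else 0) = -(c * ∑ j ∈ T, x j) := by
    rw [Finset.sum_ite_mem, Finset.inter_eq_right.2 hT, Finset.sum_neg_distrib, Finset.mul_sum]
  have e₁ : ∑ j ∈ s, (if j ∈ T then 0 else c * x j) =
      c * (∑ j ∈ s, x j - ∑ j ∈ T, x j) := by
    rw [← Finset.sum_sdiff_eq_sub hT, Finset.mul_sum, Finset.sdiff_eq_filter, Finset.sum_filter]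
    exact Finset.sum_congr rfl fun j _ => by split_ifs <;> rfl
  have q₀ := degree_X_mul_quadProd_sub (fun j => if j ∈ T then -(c * x j) else 0) x s
  have q₁ := degree_X_mul_quadProd_sub (fun j => if j ∈ T then 0 else c * x j) x s
  rw [e₀] at q₀
  rw [e₁] at q₁
  have bound : ∀ {Q p : Polynomial F}, Q.degree < ((2 * #s : ℕ) : WithBot ℕ) →
      p.degree ≤ (d : WithBot ℕ) → (Q * p).degree < ((2 * #s + d : ℕ) : WithBot ℕ) := by
    intro Q p hQ hp
    rw [Polynomial.degree_mul, Nat.cast_add]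
    exact (add_le_add_right hp _).trans_lt
      (WithBot.add_lt_add_right (WithBot.natCast_ne_bot _) hQ)
  have b₀ := bound q₀ (h₀ T)
  have b₁ := bound q₁ (h₁ T)
  rw [← mul_left_comm, ← mul_left_comm (Polynomial.C _), ← mul_sub, ← Polynomial.smul_eq_C_mul]
  refine (Polynomial.degree_smul_le _ _).trans_lt ?_
  refine lt_of_eq_of_lt (congrArg _ ?_)
    ((Polynomial.degree_sub_le _ _).trans_lt (max_lt b₀ b₁))
  ring

lemma crossSum_congr {p q : Finset ι → F} (h : ∀ T ⊆ s, p T = q T) :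
    crossSum c x s p = crossSum c x s q :=
  Finset.sum_congr rfl fun T hT => by rw [h T (Finset.mem_powerset.1 hT)]

lemma crossSum_add (p q : Finset ι → F) :
    crossSum c x s (fun T => p T + q T) = crossSum c x s p + crossSum c x s q := by
  simp only [crossSum, mul_add, Finset.sum_add_distrib]

lemma crossSum_const_mul (a : F) (p : Finset ι → F) :
    crossSum c x s (fun T => a * p T) = a * crossSum c x s p := by
  simp only [crossSum, Finset.mul_sum, mul_left_comm]

/-- The alternating sum of the weights vanishes. -/
lemma crossSum_one_eq_zero (h2 : (2 : F) ≠ 0) (hx : ∀ i, x i ≠ 0) (hs : s.Nonempty)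
    (hd : ∀ i ∈ s, ∀ j ∈ s, i ≠ j → x i ^ 2 - x j ^ 2 ≠ 0) :
    crossSum c x s (fun _ => 1) = 0 := by
  induction s using Finset.strongInduction with
  | H s ih =>
    obtain ⟨n, hn⟩ := hs
    obtain ⟨s, hns, rfl⟩ : ∃ t, n ∉ t ∧ insert n t = s :=
      ⟨s.erase n, Finset.notMem_erase n s, Finset.insert_erase hn⟩
    have hdn : ∀ j ∈ s, x n ^ 2 - x j ^ 2 ≠ 0 := fun j hj =>
      hd n hn j (Finset.mem_insert_of_mem hj) (by rintro rfl; exact hns hj)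
    have hds : ∀ i ∈ s, ∀ j ∈ s, i ≠ j → x i ^ 2 - x j ^ 2 ≠ 0 := fun i hi j hj =>
      hd i (Finset.mem_insert_of_mem hi) j (Finset.mem_insert_of_mem hj)
    have hR : clearedSum c x s (fun _ => 1) (fun _ => 1) = 0 := by
      refine eq_zero_of_eval_pm h2 hx hds ?_ ?_ ?_
      · apply degree_lt_of_degree_X_mul_lt
        have h := degree_X_mul_clearedSum_sub (c := c) (x := x) (s := s) (d := 0)
          (p₀ := fun _ => 1) (p₁ := fun _ => 1) (fun _ => Polynomial.degree_one_le)
          (fun _ => Polynomial.degree_one_le)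
        have h' : ∑ T ∈ s.powerset, Polynomial.C (crossWeight c x s T) *
            ((Polynomial.X + Polynomial.C (-(c * ∑ j ∈ T, x j))) * 1 -
              (Polynomial.X + Polynomial.C (c * (∑ j ∈ s, x j - ∑ j ∈ T, x j))) * 1) =
            Polynomial.C (∑ T ∈ s.powerset, crossWeight c x s T * (-(c * ∑ j ∈ s, x j))) := by
          rw [map_sum]
          refine Finset.sum_congr rfl fun T _ => ?_
          simp only [map_sub, map_mul, map_neg]
          ring
        rw [h'] at h
        rw [← sub_add_cancel (Polynomial.X * _) _]
        refine (Polynomial.degree_add_le _ _).trans_lt (max_lt (h.trans ?_) ?_)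
        · exact_mod_cast Nat.lt_succ_self _
        · rw [mul_comm]
          refine (Polynomial.degree_C_mul_X_pow_le _ _).trans_lt ?_
          exact_mod_cast Nat.lt_succ_self _
      · intro k hk
        obtain ⟨s, hks, rfl⟩ : ∃ t, k ∉ t ∧ insert k t = s :=
          ⟨s.erase k, Finset.notMem_erase k s, Finset.insert_erase hk⟩
        exact eval_clearedSum_insert_self hks (fun j hj => hds k hk j
          (Finset.mem_insert_of_mem hj) (by rintro rfl; exact hks hj)) fun _ _ => rfl
      · intro k hk
        obtain ⟨s, hks, rfl⟩ : ∃ t, k ∉ t ∧ insert k t = s :=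
          ⟨s.erase k, Finset.notMem_erase k s, Finset.insert_erase hk⟩
        rw [eval_clearedSum_insert_neg hks (fun j hj => hds k hk j
          (Finset.mem_insert_of_mem hj) (by rintro rfl; exact hks hj))]
        simp only [Polynomial.eval_one]
        rcases s.eq_empty_or_nonempty with rfl | hs
        · simp
        · rw [ih s ((Finset.ssubset_insert hks).trans (Finset.ssubset_insert hns)) hs
            fun i hi j hj => hds i (Finset.mem_insert_of_mem hi) j (Finset.mem_insert_of_mem hj)]
          ring
    have h := eval_clearedSum_eq_crossSum_insert (c := c) hns hdn (fun _ => 1) (fun _ => 1)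
      (fun _ => 1) (fun _ _ => Polynomial.eval_one) (fun _ _ => Polynomial.eval_one)
    rw [hR, Polynomial.eval_zero] at h
    exact (mul_eq_zero.1 h.symm).resolve_left (Finset.prod_ne_zero_iff.2 hdn)

lemma degree_X_mul_clearedSum_balance {σ : F} (h1 : crossSum c x s (fun _ => 1) = 0)
    (hb : (∑ i ∈ s, x i) * crossSum c x s (fun T => ∑ i ∈ T, (x i)⁻¹) -
      σ * (∑ i ∈ s, (x i)⁻¹) * crossSum c x s (fun T => ∑ i ∈ T, x i) = 0) :
    (Polynomial.X * clearedSum c x s (balancePoly x s σ)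
      (fun T => balancePoly x s σ T + balanceShift x s σ)).degree <
        ((2 * #s + 2 : ℕ) : WithBot ℕ) := by
  have h₀ : ∀ T, (balancePoly x s σ T).degree ≤ ((2 : ℕ) : WithBot ℕ) := fun _ =>
    Polynomial.degree_quadratic_le
  have h₁ : ∀ T, (balancePoly x s σ T + balanceShift x s σ).degree ≤ ((2 : ℕ) : WithBot ℕ) :=
    fun T => (Polynomial.degree_add_le _ _).trans (max_le (h₀ T) Polynomial.degree_quadratic_le)
  have h := degree_X_mul_clearedSum_sub (c := c) (x := x) (s := s) h₀ h₁
  set a := ∑ i ∈ s, x i with ha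
  set b := ∑ i ∈ s, (x i)⁻¹ with hb'
  have h3 : crossSum c x s (fun _ => -(σ * b) * 1) = 0 := by
    rw [crossSum_const_mul, h1, mul_zero]
  have h2 : crossSum c x s (fun T => -(c * a) * (∑ i ∈ T, (x i)⁻¹) +
      σ * b * c * (∑ i ∈ T, x i) + -(1 + σ + σ * b * c * a) * 1) = 0 := by
    rw [crossSum_add, crossSum_add, crossSum_const_mul, crossSum_const_mul, crossSum_const_mul,
      h1]
    linear_combination -c * hb
  have lead : ∑ T ∈ s.powerset, Polynomial.C (crossWeight c x s T) *
      ((Polynomial.X + Polynomial.C (-(c * ∑ j ∈ T, x j))) * balancePoly x s σ T -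
        (Polynomial.X + Polynomial.C (c * (a - ∑ j ∈ T, x j))) *
          (balancePoly x s σ T + balanceShift x s σ)) =
      Polynomial.C (crossSum c x s (fun _ => -(σ * b) * 1)) * Polynomial.X ^ 3 +
      Polynomial.C (crossSum c x s (fun T => -(c * a) * (∑ i ∈ T, (x i)⁻¹) +
        σ * b * c * (∑ i ∈ T, x i) + -(1 + σ + σ * b * c * a) * 1)) * Polynomial.X ^ 2 +
      (Polynomial.C (crossSum c x s fun T => -(c * a * (a * (∑ i ∈ T, (x i)⁻¹) +
          σ * b * ∑ i ∈ T, x i)) - a - (1 + σ) * c * (a - ∑ i ∈ T, x i)) * Polynomial.X +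
        Polynomial.C (crossSum c x s fun T => -(c * a * σ * ∑ i ∈ T, x i) -
          c * a * (a - ∑ i ∈ T, x i))) := by
    simp only [crossSum]
    rw [map_sum, map_sum, map_sum, map_sum, Finset.sum_mul, Finset.sum_mul, Finset.sum_mul,
      ← Finset.sum_add_distrib, ← Finset.sum_add_distrib, ← Finset.sum_add_distrib]
    refine Finset.sum_congr rfl fun T _ => ?_
    rw [balancePoly, balanceShift, ← ha, ← hb']
    generalize ∑ i ∈ T, x i = α
    generalize ∑ i ∈ T, (x i)⁻¹ = β
    simp only [map_add, map_sub, map_mul, map_neg, map_one]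
    ring
  rw [lead, h2, h3] at h
  rw [← sub_add_cancel (Polynomial.X * _) _]
  refine (Polynomial.degree_add_le _ _).trans_lt (max_lt h ?_)
  simp only [map_zero, zero_mul, zero_add]
  rw [Polynomial.degree_mul, Polynomial.degree_X_pow, Nat.cast_add]
  exact WithBot.add_lt_add_left (WithBot.natCast_ne_bot _) Polynomial.degree_linear_lt

/-- The balance between the sums weighted by `∑ x i` and by `∑ (x i)⁻¹`. -/
lemma crossSum_balance (h2 : (2 : F) ≠ 0) (hx : ∀ i, x i ≠ 0)
    (hd : ∀ i ∈ s, ∀ j ∈ s, i ≠ j → x i ^ 2 - x j ^ 2 ≠ 0) :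
    (∑ i ∈ s, x i) * crossSum c x s (fun T => ∑ i ∈ T, (x i)⁻¹) +
      (-1) ^ #s * (∑ i ∈ s, (x i)⁻¹) * crossSum c x s (fun T => ∑ i ∈ T, x i) = 0 := by
  induction s using Finset.strongInduction with
  | H s ih =>
    rcases s.eq_empty_or_nonempty with rfl | ⟨n, hn⟩
    · simp
    obtain ⟨s, hns, rfl⟩ : ∃ t, n ∉ t ∧ insert n t = s :=
      ⟨s.erase n, Finset.notMem_erase n s, Finset.insert_erase hn⟩
    rcases s.eq_empty_or_nonempty with rfl | hs
    · have := hx n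
      simp only [crossSum, Finset.sum_powerset_insert (Finset.notMem_empty n)]
      simp [crossWeight, this]
    have hdn : ∀ j ∈ s, x n ^ 2 - x j ^ 2 ≠ 0 := fun j hj =>
      hd n hn j (Finset.mem_insert_of_mem hj) (by rintro rfl; exact hns hj)
    have hds : ∀ i ∈ s, ∀ j ∈ s, i ≠ j → x i ^ 2 - x j ^ 2 ≠ 0 := fun i hi j hj =>
      hd i (Finset.mem_insert_of_mem hi) j (Finset.mem_insert_of_mem hj)
    have h1 := crossSum_one_eq_zero (c := c) h2 hx hs hds
    set σ : F := (-1) ^ #(insert n s) with hσ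
    have hσs : (-1) ^ #s = -σ := by
      rw [hσ, Finset.card_insert_of_notMem hns]; ring
    have hR : clearedSum c x s (balancePoly x s σ)
        (fun T => balancePoly x s σ T + balanceShift x s σ) = 0 := by
      have hdeg := degree_X_mul_clearedSum_balance (σ := σ) h1 (by
        have := ih s (Finset.ssubset_insert hns) hds
        rw [hσs] at this
        linear_combination this)
      have hroot : (clearedSum c x s (balancePoly x s σ)
          (fun T => balancePoly x s σ T + balanceShift x s σ)).eval 0 = 0 := by
        have h : (clearedSum c x s (balancePoly x s σ)
            (fun T => balancePoly x s σ T + balanceShift x s σ)).eval 0 =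
            -((∏ j ∈ s, -x j ^ 2) * ∑ i ∈ s, x i) * crossSum c x s (fun _ => 1) := by
          rw [eval_clearedSum, crossSum, Finset.mul_sum]
          refine Finset.sum_congr rfl fun T hT => ?_
          rw [← Finset.prod_sdiff (Finset.mem_powerset.1 hT), Polynomial.eval_add,
            eval_balanceShift]
          simp only [mul_zero, zero_mul, sub_zero, add_zero, zero_pow two_ne_zero, zero_sub,
            zero_add]
          ring
        rw [h, h1, mul_zero]
      obtain ⟨R, hR⟩ := Polynomial.X_dvd_iff.2
        ((Polynomial.coeff_zero_eq_eval_zero _).trans hroot)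
      have heval : ∀ y : F, y ≠ 0 → (clearedSum c x s (balancePoly x s σ)
          (fun T => balancePoly x s σ T + balanceShift x s σ)).eval y = 0 → R.eval y = 0 := by
        intro y hy h
        rw [hR, Polynomial.eval_mul, Polynomial.eval_X] at h
        exact (mul_eq_zero.1 h).resolve_left hy
      suffices h : R = 0 by rw [hR, h, mul_zero]
      refine eq_zero_of_eval_pm h2 hx hds ?_ (fun k hk => heval _ (hx k) ?_)
        (fun k hk => heval _ (neg_ne_zero.2 (hx k)) ?_)
      · rw [hR] at hdeg
        exact degree_lt_of_degree_X_mul_lt (degree_lt_of_degree_X_mul_lt hdeg)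
      · obtain ⟨s, hks, rfl⟩ : ∃ t, k ∉ t ∧ insert k t = s :=
          ⟨s.erase k, Finset.notMem_erase k s, Finset.insert_erase hk⟩
        refine eval_clearedSum_insert_self hks (fun j hj => hds k hk j
          (Finset.mem_insert_of_mem hj) (by rintro rfl; exact hks hj)) fun T hT => ?_
        have hkT : k ∉ T := fun h => hks (hT h)
        have := hx k
        rw [Polynomial.eval_add, eval_balancePoly, eval_balancePoly, eval_balanceShift,
          Finset.sum_insert hkT, Finset.sum_insert hkT]
        field_simp
        ring
      · obtain ⟨s, hks, rfl⟩ : ∃ t, k ∉ t ∧ insert k t = s :=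
          ⟨s.erase k, Finset.notMem_erase k s, Finset.insert_erase hk⟩
        have hk0 := hx k
        have hds' : ∀ i ∈ s, ∀ j ∈ s, i ≠ j → x i ^ 2 - x j ^ 2 ≠ 0 := fun i hi j hj =>
          hds i (Finset.mem_insert_of_mem hi) j (Finset.mem_insert_of_mem hj)
        have hbal := ih s ((Finset.ssubset_insert hks).trans (Finset.ssubset_insert hns)) hds'
        have hσs' : (-1) ^ #s = σ := by
          rw [Finset.card_insert_of_notMem hks, pow_succ] at hσs
          linear_combination -hσs
        have hone : (∑ i ∈ s, x i) * crossSum c x s (fun _ => 1) = 0 ∧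
            (∑ i ∈ s, (x i)⁻¹) * crossSum c x s (fun _ => 1) = 0 := by
          rcases s.eq_empty_or_nonempty with rfl | hs
          · simp
          · rw [crossSum_one_eq_zero h2 hx hs hds']
            simp
        rw [hσs'] at hbal
        have e₀ : crossSum c x s (fun T =>
            (balancePoly x (insert k s) σ (insert k T)).eval (-x k)) = 0 := by
          have h : crossSum c x s (fun T =>
              (balancePoly x (insert k s) σ (insert k T)).eval (-x k)) =
              crossSum c x s (fun T => -(x k * ∑ i ∈ s, x i) * (∑ i ∈ T, (x i)⁻¹) +
                -(x k * σ * ∑ i ∈ s, (x i)⁻¹) * (∑ i ∈ T, x i) +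
                (-(∑ i ∈ s, x i) - x k ^ 2 * σ * ∑ i ∈ s, (x i)⁻¹) * 1) := by
            refine crossSum_congr fun T hT => ?_
            have hkT : k ∉ T := fun h => hks (hT h)
            rw [eval_balancePoly, Finset.sum_insert hkT, Finset.sum_insert hkT,
              Finset.sum_insert hks, Finset.sum_insert hks]
            field_simp
            ring
          rw [h, crossSum_add, crossSum_add, crossSum_const_mul, crossSum_const_mul,
            crossSum_const_mul]
          linear_combination -x k * hbal - hone.1 - x k ^ 2 * σ * hone.2
        have e₁ : crossSum c x s (fun T =>
            (balancePoly x (insert k s) σ T + balanceShift x (insert k s) σ).eval (-x k)) =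
            0 := by
          have h : crossSum c x s (fun T =>
              (balancePoly x (insert k s) σ T + balanceShift x (insert k s) σ).eval (-x k)) =
              crossSum c x s (fun T => -(x k * ∑ i ∈ s, x i) * (∑ i ∈ T, (x i)⁻¹) +
                -(x k * σ * ∑ i ∈ s, (x i)⁻¹) * (∑ i ∈ T, x i) +
                ((∑ i ∈ s, x i) + x k ^ 2 * σ * ∑ i ∈ s, (x i)⁻¹) * 1) := by
            refine crossSum_congr fun T hT => ?_
            rw [Polynomial.eval_add, eval_balancePoly, eval_balanceShift,
              Finset.sum_insert hks, Finset.sum_insert hks]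
            field_simp
            ring
          rw [h, crossSum_add, crossSum_add, crossSum_const_mul, crossSum_const_mul,
            crossSum_const_mul]
          linear_combination -x k * hbal + hone.1 + x k ^ 2 * σ * hone.2
        rw [eval_clearedSum_insert_neg hks (fun j hj => hds k hk j
          (Finset.mem_insert_of_mem hj) (by rintro rfl; exact hks hj)), e₀, e₁]
        ring
    have hn0 := hx n
    have h := eval_clearedSum_eq_crossSum_insert (c := c) hns hdn (balancePoly x s σ)
      (fun T => balancePoly x s σ T + balanceShift x s σ)
      (fun T => x n * (∑ i ∈ insert n s, x i) * (∑ i ∈ T, (x i)⁻¹) +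
        x n * σ * (∑ i ∈ insert n s, (x i)⁻¹) * ∑ i ∈ T, x i)
      (fun T hT => by
        rw [eval_balancePoly, Finset.sum_insert hns, Finset.sum_insert hns]
        field_simp)
      (fun T hT => by
        have hnT : n ∉ T := fun h => hns (hT h)
        rw [Polynomial.eval_add, eval_balancePoly, eval_balanceShift, Finset.sum_insert hns,
          Finset.sum_insert hns, Finset.sum_insert hnT, Finset.sum_insert hnT]
        field_simp
        ring)
    rw [hR, Polynomial.eval_zero] at h
    have h' := (mul_eq_zero.1 h.symm).resolve_left (Finset.prod_ne_zero_iff.2 hdn)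
    rw [crossSum_add, crossSum_const_mul, crossSum_const_mul] at h'
    refine mul_left_cancel₀ hn0 ?_
    linear_combination h'

end

/-- An ordered double product of a symmetric function that is trivial on pairs not separated
by `T`, written as a product over the separated pairs. -/
lemma prod_prod_ite_lt_eq_prod_prod_compl {n : ℕ} {M : Type*} [CommMonoid M]
    (T : Finset (Fin n)) (f g : Fin n → Fin n → M)
    (h₁ : ∀ i j, i ∈ T → j ∉ T → f i j = g i j) (h₂ : ∀ i j, i ∈ T → j ∉ T → f j i = g i j)
    (h₃ : ∀ i j, (i ∈ T ↔ j ∈ T) → f i j = 1) :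
    (∏ i : Fin n, ∏ j : Fin n, if (i : ℕ) < (j : ℕ) then f i j else 1) =
      ∏ i ∈ T, ∏ j ∈ Finset.univ \ T, g i j := by
  have e : ∏ i ∈ T, ∏ j ∈ Finset.univ \ T, g i j =
      ∏ i : Fin n, ∏ j : Fin n, if i ∈ T ∧ j ∉ T then g i j else 1 := by
    simp_rw [ite_and, Finset.prod_ite_irrel, Finset.prod_const_one, ← Finset.prod_filter]
    simp [Finset.sdiff_eq_filter]
  have split : ∀ i j : Fin n, (if i ∈ T ∧ j ∉ T then g i j else 1) =
      (if (i : ℕ) < (j : ℕ) then (if i ∈ T ∧ j ∉ T then g i j else 1) else 1) *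
        if (j : ℕ) < (i : ℕ) then (if i ∈ T ∧ j ∉ T then g i j else 1) else 1 := by
    intro i j
    rcases lt_trichotomy (i : ℕ) (j : ℕ) with h | h | h
    · simp [h, h.not_gt]
    · simp [Fin.ext h]
    · simp [h, h.not_gt]
  rw [e, Finset.prod_congr rfl fun i _ => Finset.prod_congr rfl fun j _ => split i j]
  simp_rw [Finset.prod_mul_distrib]
  rw [Finset.prod_comm (f := fun i j : Fin n =>
    if (j : ℕ) < (i : ℕ) then (if i ∈ T ∧ j ∉ T then g i j else 1) else 1),
    ← Finset.prod_mul_distrib]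
  refine Finset.prod_congr rfl fun i _ => ?_
  rw [← Finset.prod_mul_distrib]
  refine Finset.prod_congr rfl fun j _ => ?_
  by_cases hij : (i : ℕ) < (j : ℕ)
  · by_cases hi : i ∈ T <;> by_cases hj : j ∈ T
    · simp [hij, hi, hj, h₃ i j (by tauto)]
    · simp [hij, hi, hj, h₁ i j hi hj]
    · simp [hij, hi, hj, h₂ j i hj hi]
    · simp [hij, hi, hj, h₃ i j (by tauto)]
  · simp [hij]

/-- The factor `i sin(πν) / sinh(a - b)` in the variables `exp a`, `exp b`. -/
lemma I_mul_div_sinh_eq (t a b : ℂ) :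
    Complex.I * t / Complex.sinh (a - b) =
      2 * Complex.I * t * Complex.exp a * Complex.exp b /
        (Complex.exp a ^ 2 - Complex.exp b ^ 2) := by
  have ha := Complex.exp_ne_zero a
  have hb := Complex.exp_ne_zero b
  have h : Complex.exp a ^ 2 - Complex.exp b ^ 2 =
      2 * Complex.exp a * Complex.exp b * Complex.sinh (a - b) := by
    rw [Complex.sinh, neg_sub, Complex.exp_sub, Complex.exp_sub]
    field_simp
  rw [h]
  by_cases hs : Complex.sinh (a - b) = 0
  · simp [hs]
  · field_simp

/-- The K-function as a sum over subsets. -/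
lemma Kfun_eq_crossSum (ν : ℝ) {n : ℕ} (p : (Fin n → ℂ) → (Fin n → Fin 2) → ℂ)
    (θ : Fin n → ℂ) :
    Kfun ν p θ = crossSum (2 * Complex.I * (Real.sin (Real.pi * ν) : ℂ))
      (fun i => Complex.exp (θ i)) Finset.univ
      (fun T => p θ fun i => if i ∈ T then 1 else 0) := by
  rw [Kfun, crossSum, Finset.powerset_univ]
  refine (Finset.sum_bij' (fun T _ i => if i ∈ T then 1 else 0)
    (fun l _ => Finset.univ.filter fun i => l i = 1) (fun _ _ => Finset.mem_univ _)
    (fun _ _ => Finset.mem_univ _) (fun T _ => ?_) (fun l _ => ?_) (fun T _ => ?_)).symm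
  · ext i
    simp
  · funext i
    have : l i = 0 ∨ l i = 1 := by omega
    rcases this with h | h <;> simp [h]
  · rw [crossWeight]
    congr 2
    · congr 1
      simp [apply_ite (fun a : Fin 2 => (a : ℕ))]
    · symm
      refine prod_prod_ite_lt_eq_prod_prod_compl T _ _ (fun i j hi hj => ?_)
        (fun i j hi hj => ?_) (fun i j hij => ?_)
      · rw [← I_mul_div_sinh_eq]
        simp [hi, hj]
      · rw [← I_mul_div_sinh_eq, ← neg_sub (θ i), Complex.sinh_neg, div_neg]
        simp [hi, hj, neg_div]
      · by_cases hi : i ∈ T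
        · simp [hi, hij.1 hi]
        · simp [hi, mt hij.2 hi]

lemma exp_sq_sub_exp_sq_ne_zero {a b : ℂ} (h : Complex.sinh (a - b) ≠ 0) :
    Complex.exp a ^ 2 - Complex.exp b ^ 2 ≠ 0 := by
  intro h0
  apply h
  have hab : Complex.exp (a - b) ^ 2 = 1 := by
    rw [Complex.exp_sub, div_pow, div_eq_one_iff_eq (pow_ne_zero _ (Complex.exp_ne_zero b))]
    exact sub_eq_zero.1 h0
  rw [Complex.sinh, Complex.exp_neg]
  have := Complex.exp_ne_zero (a - b)
  field_simp
  linear_combination hab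

lemma exp_shift_one (ν : ℝ) (a : ℂ) (l : ℕ) :
    Complex.exp (1 * (a - (Real.pi : ℂ) * Complex.I / 2 * (1 - (-1 : ℂ) ^ l * (ν : ℂ)))) =
      -Complex.I * Complex.exp ((-1) ^ l * (Real.pi * Complex.I / 2 * ν)) * Complex.exp a := by
  have h : Complex.exp (-(Real.pi / 2 * Complex.I)) = -Complex.I := by
    rw [Complex.exp_neg, Complex.exp_pi_div_two_mul_I, Complex.inv_I]
  rw [← h, ← Complex.exp_add, ← Complex.exp_add]
  congr 1
  ring

lemma exp_shift_neg_one (ν : ℝ) (a : ℂ) (l : ℕ) :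
    Complex.exp (-1 * (a - (Real.pi : ℂ) * Complex.I / 2 * (1 - (-1 : ℂ) ^ l * (ν : ℂ)))) =
      Complex.I * Complex.exp (-((-1) ^ l * (Real.pi * Complex.I / 2 * ν))) *
        (Complex.exp a)⁻¹ := by
  have h := Complex.exp_pi_div_two_mul_I
  rw [← Complex.exp_neg a]
  nth_rewrite 2 [← h]
  rw [← Complex.exp_add, ← Complex.exp_add]
  congr 1
  ring

lemma sum_ite_mem_mul {ι F : Type*} [Fintype ι] [DecidableEq ι] [CommRing F] (T : Finset ι)
    (u v : F) (y : ι → F) :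
    ∑ i, (if i ∈ T then v else u) * y i = u * ∑ i, y i + (v - u) * ∑ i ∈ T, y i := by
  have h : ∑ i ∈ T, y i = ∑ i, if i ∈ T then y i else 0 := by simp
  rw [h, Finset.mul_sum, Finset.mul_sum, ← Finset.sum_add_distrib]
  refine Finset.sum_congr rfl fun i _ => ?_
  split_ifs <;> ring

lemma pPM_one_eq (ν : ℝ) {n : ℕ} (θ : Fin n → ℂ) (T : Finset (Fin n)) :
    pPM ν 1 θ (fun i => if i ∈ T then 1 else 0) =
      (∑ i, (Complex.exp (θ i))⁻¹) * (-Complex.I) *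
        (Complex.exp (Real.pi * Complex.I / 2 * ν) * (∑ i, Complex.exp (θ i)) * 1 +
          (Complex.exp (-(Real.pi * Complex.I / 2 * ν)) -
            Complex.exp (Real.pi * Complex.I / 2 * ν)) * ∑ i ∈ T, Complex.exp (θ i)) := by
  have h : ∀ i, Complex.exp (1 * (θ i - (Real.pi : ℂ) * Complex.I / 2 *
      (1 - (-1 : ℂ) ^ (((if i ∈ T then 1 else 0 : Fin 2)) : ℕ) * (ν : ℂ)))) =
      -Complex.I * ((if i ∈ T then Complex.exp (-(Real.pi * Complex.I / 2 * ν)) else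
        Complex.exp (Real.pi * Complex.I / 2 * ν)) * Complex.exp (θ i)) := by
    intro i
    rw [exp_shift_one]
    split_ifs <;> simp [mul_assoc]
  rw [pPM, Finset.sum_congr rfl fun i _ => h i, ← Finset.mul_sum, sum_ite_mem_mul]
  simp only [neg_mul, one_mul, Complex.exp_neg (θ _)]
  ring

lemma pPM_neg_one_eq (ν : ℝ) {n : ℕ} (θ : Fin n → ℂ) (T : Finset (Fin n)) :
    pPM ν (-1) θ (fun i => if i ∈ T then 1 else 0) =
      (∑ i, Complex.exp (θ i)) * Complex.I *
        (Complex.exp (-(Real.pi * Complex.I / 2 * ν)) * (∑ i, (Complex.exp (θ i))⁻¹) * 1 +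
          (Complex.exp (Real.pi * Complex.I / 2 * ν) -
            Complex.exp (-(Real.pi * Complex.I / 2 * ν))) *
              ∑ i ∈ T, (Complex.exp (θ i))⁻¹) := by
  have h : ∀ i, Complex.exp (-1 * (θ i - (Real.pi : ℂ) * Complex.I / 2 *
      (1 - (-1 : ℂ) ^ (((if i ∈ T then 1 else 0 : Fin 2)) : ℕ) * (ν : ℂ)))) =
      Complex.I * ((if i ∈ T then Complex.exp (Real.pi * Complex.I / 2 * ν) else
        Complex.exp (-(Real.pi * Complex.I / 2 * ν))) * (Complex.exp (θ i))⁻¹) := by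
    intro i
    rw [exp_shift_neg_one]
    split_ifs <;> simp [mul_assoc]
  rw [pPM, Finset.sum_congr rfl fun i _ => h i, ← Finset.mul_sum, sum_ite_mem_mul]
  simp only [neg_neg, one_mul]
  ring

/-- Lemma 2, second identity: `K̃_n^{−}(θ) = (−1)^{n+1} K̃_n^{+}(θ)`. -/
theorem Ktilde_minus_eq (ν : ℝ) (n : ℕ) (hn : 1 ≤ n)
    (θ : Fin n → ℂ) (hθ : Admissible θ) :
    Kfun ν (pPM ν (-1)) θ = (-1 : ℂ) ^ (n + 1) * Kfun ν (pPM ν 1) θ := by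
  have hd : ∀ i ∈ (Finset.univ : Finset (Fin n)), ∀ j ∈ (Finset.univ : Finset (Fin n)), i ≠ j →
      Complex.exp (θ i) ^ 2 - Complex.exp (θ j) ^ 2 ≠ 0 := by
    intro i _ j _ hij
    rcases lt_or_gt_of_ne hij with h | h
    · exact exp_sq_sub_exp_sq_ne_zero (hθ i j h)
    · rw [← neg_sub]
      exact neg_ne_zero.2 (exp_sq_sub_exp_sq_ne_zero (hθ j i h))
  have hne : (Finset.univ : Finset (Fin n)).Nonempty := ⟨⟨0, hn⟩, Finset.mem_univ _⟩
  have hx : ∀ i, Complex.exp (θ i) ≠ 0 := fun i => Complex.exp_ne_zero _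
  have h1 := crossSum_one_eq_zero (c := 2 * Complex.I * (Real.sin (Real.pi * ν) : ℂ))
    two_ne_zero hx hne hd
  have hb := crossSum_balance (c := 2 * Complex.I * (Real.sin (Real.pi * ν) : ℂ))
    two_ne_zero hx hd
  rw [Finset.card_univ, Fintype.card_fin] at hb
  rw [Kfun_eq_crossSum, Kfun_eq_crossSum]
  simp only [pPM_one_eq, pPM_neg_one_eq]
  rw [crossSum_const_mul, crossSum_const_mul, crossSum_add, crossSum_add, crossSum_const_mul,
    crossSum_const_mul, crossSum_const_mul, crossSum_const_mul, h1, pow_succ]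
  linear_combination Complex.I * (Complex.exp (Real.pi * Complex.I / 2 * ν) -
    Complex.exp (-(Real.pi * Complex.I / 2 * ν))) * hb
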